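/- For the Cayley graph Γ of BS(1,N) with respect to {a,b}, the boundary edge counts γ_m = |E(R_m, Γ∖R_m)| of the rectangles R_m = {aᵏ bⁱ : 0 ≤ k < Nᵐ, 0 ≤ i < m} satisfy γ_1 = 2N + 2, γ_m = 2 + N·γ_{m−1} for m ≥ 2, and hence γ_m = 2(N^{m+1} − 1)/(N − 1) for all m ≥ 1. -/

import Mathlib

/-- The Baumslag–Solitar group `BS(1,N) = ⟨a, b | b a b⁻¹ = aᴺ⟩`. -/
abbrev BSGroup (N : ℕ) : Type :=
  PresentedGroup ({FreeGroup.of true * FreeGroup.of false * (FreeGroup.of true)⁻¹ *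
    ((FreeGroup.of false) ^ N)⁻¹} : Set (FreeGroup Bool))

/-- The generator `a` of `BS(1,N)`. -/
def bsa (N : ℕ) : BSGroup N := PresentedGroup.of false

/-- The generator `b` of `BS(1,N)`. -/
def bsb (N : ℕ) : BSGroup N := PresentedGroup.of true

/-- The rectangle `R_m = {aᵏ bⁱ : 0 ≤ k < Nᵐ, 0 ≤ i < m}` in `BS(1,N)`. -/
def bsRect (N m : ℕ) : Set (BSGroup N) :=
  {g | ∃ k i : ℕ, k < N ^ m ∧ i < m ∧ g = (bsa N) ^ k * (bsb N) ^ i}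

/-- The number of edges of the Cayley graph of `BS(1,N)` (w.r.t. `{a,b}`) joining a set `F`
to its complement, counted as the set of ordered pairs (inner endpoint, outer endpoint). -/
noncomputable def bsBoundary (N : ℕ) (F : Set (BSGroup N)) : ℕ :=
  Set.ncard {p : BSGroup N × BSGroup N | p.1 ∈ F ∧ p.2 ∉ F ∧
    (p.2 = p.1 * bsa N ∨ p.2 = p.1 * bsb N ∨ p.1 = p.2 * bsa N ∨ p.1 = p.2 * bsb N)}

theorem bsb_mul_bsa (N : ℕ) : bsb N * bsa N = bsa N ^ N * bsb N := by
  have h := PresentedGroup.one_of_mem (rels := ({FreeGroup.of true * FreeGroup.of false *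
    (FreeGroup.of true)⁻¹ * ((FreeGroup.of false) ^ N)⁻¹} : Set (FreeGroup Bool)))
    (Set.mem_singleton _)
  simp only [map_mul, map_inv, map_pow] at h
  rw [mul_inv_eq_one, mul_inv_eq_iff_eq_mul] at h
  exact h

theorem bsb_mul_bsa_pow (N k : ℕ) : bsb N * bsa N ^ k = bsa N ^ (N * k) * bsb N := by
  rw [pow_mul]
  exact ((show SemiconjBy (bsb N) (bsa N) (bsa N ^ N) from bsb_mul_bsa N).pow_right k).eq

theorem bsb_pow_mul_bsa (N i : ℕ) : bsb N ^ i * bsa N = bsa N ^ N ^ i * bsb N ^ i := by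
  induction i with
  | zero => simp
  | succ i ih =>
    rw [pow_succ', mul_assoc, ih, ← mul_assoc, bsb_mul_bsa_pow, ← pow_succ', mul_assoc]

theorem bs_normal_mul_bsa (N k i : ℕ) :
    bsa N ^ k * bsb N ^ i * bsa N = bsa N ^ (k + N ^ i) * bsb N ^ i := by
  rw [mul_assoc, bsb_pow_mul_bsa, ← mul_assoc, pow_add]

theorem bs_normal_mul_bsb (N k i : ℕ) :
    bsa N ^ k * bsb N ^ i * bsb N = bsa N ^ k * bsb N ^ (i + 1) := by
  rw [mul_assoc, pow_succ]

/-- The affine action of `BS(1,N)` on `ℚ`: `a` acts by `x ↦ x + 1` and `b` by `x ↦ N x`. -/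
noncomputable def bsAffine (N : ℕ) (hN : (N : ℚ) ≠ 0) : BSGroup N →* Equiv.Perm ℚ :=
  PresentedGroup.toGroup
    (f := fun t => if t then Equiv.mulLeft₀ (N : ℚ) hN else Equiv.addRight 1) (by
      rintro r rfl
      have hpow : ∀ (n : ℕ), (Equiv.addRight (1 : ℚ)) ^ n = Equiv.addRight (n : ℚ) := by
        intro n
        simp
      simp only [map_mul, map_inv, map_pow, FreeGroup.lift_apply_of, if_true, Bool.false_eq_true,
        if_false, hpow]
      rw [mul_inv_eq_one, mul_inv_eq_iff_eq_mul]
      ext x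
      simp [mul_add])

theorem bsAffine_normal (N : ℕ) (hN : (N : ℚ) ≠ 0) (k i : ℕ) (x : ℚ) :
    bsAffine N hN (bsa N ^ k * bsb N ^ i) x = N ^ i * x + k := by
  have ha : ∀ y, bsAffine N hN (bsa N) y = y + 1 := by
    intro y
    simp [bsAffine, bsa]
  have hb : ∀ y, bsAffine N hN (bsb N) y = N * y := by
    intro y
    simp [bsAffine, bsb]
  induction k with
  | zero =>
    induction i with
    | zero => simp
    | succ i ih =>
      have hcomm : bsa N ^ 0 * bsb N ^ (i + 1) = bsb N * (bsa N ^ 0 * bsb N ^ i) := by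
        simp [pow_succ']
      rw [hcomm, map_mul, Equiv.Perm.mul_apply, ih, hb]
      push_cast
      ring
  | succ k ih =>
    rw [pow_succ', mul_assoc (bsa N), map_mul, Equiv.Perm.mul_apply, ih, ha]
    push_cast
    ring

theorem bs_normal_inj {N : ℕ} (hN : 2 ≤ N) {k i k' i' : ℕ} :
    bsa N ^ k * bsb N ^ i = bsa N ^ k' * bsb N ^ i' ↔ k = k' ∧ i = i' := by
  refine ⟨fun h => ?_, by rintro ⟨rfl, rfl⟩; rfl⟩
  have hN0 : (N : ℚ) ≠ 0 := by
    norm_cast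
    lia
  have h0 := bsAffine_normal N hN0 k i 0
  have h1 := bsAffine_normal N hN0 k i 1
  rw [h, bsAffine_normal] at h0 h1
  have hk : k' = k := by simpa using h0
  subst hk
  refine ⟨rfl, ?_⟩
  have hi : (N : ℚ) ^ i' = (N : ℚ) ^ i := by simpa using h1
  norm_cast at hi
  exact (Nat.pow_right_injective hN hi).symm

theorem mem_bsRect {N : ℕ} (hN : 2 ≤ N) {m k i : ℕ} :
    bsa N ^ k * bsb N ^ i ∈ bsRect N m ↔ k < N ^ m ∧ i < m := by
  constructor
  · rintro ⟨k', i', hk, hi, h⟩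
    obtain ⟨rfl, rfl⟩ := (bs_normal_inj hN).1 h
    exact ⟨hk, hi⟩
  · rintro ⟨hk, hi⟩
    exact ⟨k, i, hk, hi, rfl⟩

theorem mul_bsa_inv_mem_bsRect {N : ℕ} (hN : 2 ≤ N) {m k i : ℕ} (hk : k < N ^ m) (hi : i < m) :
    bsa N ^ k * bsb N ^ i * (bsa N)⁻¹ ∈ bsRect N m ↔ N ^ i ≤ k := by
  constructor
  · rintro ⟨k', i', -, -, h⟩
    rw [mul_inv_eq_iff_eq_mul, bs_normal_mul_bsa, bs_normal_inj hN] at h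
    obtain ⟨rfl, rfl⟩ := h
    exact Nat.le_add_left _ _
  · intro h
    refine ⟨k - N ^ i, i, by lia, hi, ?_⟩
    rw [mul_inv_eq_iff_eq_mul, bs_normal_mul_bsa, Nat.sub_add_cancel h]

theorem mul_bsb_inv_mem_bsRect {N : ℕ} (hN : 2 ≤ N) {m k i : ℕ} (hk : k < N ^ m) (hi : i < m) :
    bsa N ^ k * bsb N ^ i * (bsb N)⁻¹ ∈ bsRect N m ↔ 1 ≤ i := by
  constructor
  · rintro ⟨k', i', -, -, h⟩
    rw [mul_inv_eq_iff_eq_mul, bs_normal_mul_bsb, bs_normal_inj hN] at h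
    lia
  · intro h
    refine ⟨k, i - 1, hk, by lia, ?_⟩
    rw [mul_inv_eq_iff_eq_mul, bs_normal_mul_bsb, Nat.sub_add_cancel h]

theorem bsRect_finite (N m : ℕ) : (bsRect N m).Finite := by
  refine ((Finset.range (N ^ m) ×ˢ Finset.range m).finite_toSet.image
    fun p : ℕ × ℕ => bsa N ^ p.1 * bsb N ^ p.2).subset ?_
  rintro g ⟨k, i, hk, hi, rfl⟩
  exact ⟨(k, i), by simp [hk, hi], rfl⟩

/-- The boundary pairs of `F` whose edge is right multiplication by `s`. -/
def exitPairs {G : Type*} [Group G] (F : Set G) (s : G) : Set (G × G) :=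
  {p | p.1 ∈ F ∧ p.2 ∉ F ∧ p.2 = p.1 * s}

theorem exitPairs_eq_image {G : Type*} [Group G] (F : Set G) (s : G) :
    exitPairs F s = (fun g => (g, g * s)) '' {g ∈ F | g * s ∉ F} := by
  ext ⟨x, y⟩
  constructor
  · rintro ⟨hx, hy, h⟩
    obtain rfl : y = x * s := h
    exact ⟨x, ⟨hx, hy⟩, rfl⟩
  · rintro ⟨g, ⟨hx, hy⟩, h⟩
    obtain ⟨rfl, rfl⟩ := Prod.mk.inj h
    exact ⟨hx, hy, rfl⟩

theorem exitPairs_finite {G : Type*} [Group G] {F : Set G} (hF : F.Finite) (s : G) :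
    (exitPairs F s).Finite := by
  rw [exitPairs_eq_image]
  exact (hF.subset (Set.sep_subset _ _)).image _

theorem disjoint_exitPairs {G : Type*} [Group G] (F : Set G) {s t : G} (h : s ≠ t) :
    Disjoint (exitPairs F s) (exitPairs F t) := by
  rw [Set.disjoint_left]
  rintro p ⟨-, -, hs⟩ ⟨-, -, ht⟩
  exact h (mul_left_cancel (hs.symm.trans ht))

theorem ncard_exitPairs_bsRect {N : ℕ} (hN : 2 ≤ N) (m : ℕ) (s : BSGroup N) (P : ℕ → ℕ → Prop)
    [∀ k i, Decidable (P k i)]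
    (hP : ∀ k i, k < N ^ m → i < m → (bsa N ^ k * bsb N ^ i * s ∉ bsRect N m ↔ P k i)) :
    (exitPairs (bsRect N m) s).ncard =
      ∑ i ∈ Finset.range m, {k ∈ Finset.range (N ^ m) | P k i}.card := by
  rw [exitPairs_eq_image, Set.ncard_image_of_injective _ fun x y h => (Prod.mk.inj h).1]
  have himage : {g ∈ bsRect N m | g * s ∉ bsRect N m} =
      (fun p : (_ : ℕ) × ℕ => bsa N ^ p.2 * bsb N ^ p.1) ''
        ((Finset.range m).sigma fun i => {k ∈ Finset.range (N ^ m) | P k i} :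
          Finset ((_ : ℕ) × ℕ)) := by
    ext g
    constructor
    · rintro ⟨⟨k, i, hk, hi, rfl⟩, h⟩
      exact ⟨⟨i, k⟩, by simpa [hk, hi] using (hP k i hk hi).1 h, rfl⟩
    · rintro ⟨⟨i, k⟩, h, rfl⟩
      simp only [Finset.mem_coe, Finset.mem_sigma, Finset.mem_range, Finset.mem_filter] at h
      exact ⟨⟨k, i, h.2.1, h.1, rfl⟩, (hP k i h.2.1 h.1).2 h.2.2⟩
  rw [himage, Set.ncard_image_of_injective, Set.ncard_coe_finset, Finset.card_sigma]
  rintro ⟨i, k⟩ ⟨i', k'⟩ h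
  obtain ⟨rfl, rfl⟩ := (bs_normal_inj hN).1 h
  rfl

theorem bsBoundary_eq_sum {N : ℕ} (hN : 2 ≤ N) {F : Set (BSGroup N)} (hF : F.Finite) :
    bsBoundary N F = (exitPairs F (bsa N)).ncard + (exitPairs F (bsb N)).ncard +
      (exitPairs F (bsa N)⁻¹).ncard + (exitPairs F (bsb N)⁻¹).ncard := by
  have hab : bsa N ≠ bsb N := fun h => by
    have := (bs_normal_inj hN (k := 1) (i := 0) (k' := 0) (i' := 1)).1 (by simpa using h)
    lia
  have haa : bsa N ≠ (bsa N)⁻¹ := fun h => by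
    have := (bs_normal_inj hN (k := 2) (i := 0) (k' := 0) (i' := 0)).1
      (by simpa [pow_two] using mul_eq_one_iff_eq_inv.2 h)
    lia
  have hbb : bsb N ≠ (bsb N)⁻¹ := fun h => by
    have := (bs_normal_inj hN (k := 0) (i := 2) (k' := 0) (i' := 0)).1
      (by simpa [pow_two] using mul_eq_one_iff_eq_inv.2 h)
    lia
  have hab' : bsa N ≠ (bsb N)⁻¹ := fun h => by
    have := (bs_normal_inj hN (k := 1) (i := 1) (k' := 0) (i' := 0)).1
      (by simpa using mul_eq_one_iff_eq_inv.2 h)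
    lia
  have hba' : bsb N ≠ (bsa N)⁻¹ := fun h => hab' (by rw [h, inv_inv])
  have hsplit : {p : BSGroup N × BSGroup N | p.1 ∈ F ∧ p.2 ∉ F ∧
      (p.2 = p.1 * bsa N ∨ p.2 = p.1 * bsb N ∨ p.1 = p.2 * bsa N ∨ p.1 = p.2 * bsb N)} =
      exitPairs F (bsa N) ∪ exitPairs F (bsb N) ∪ exitPairs F (bsa N)⁻¹ ∪
        exitPairs F (bsb N)⁻¹ := by
    ext p
    simp only [exitPairs, Set.mem_ofPred_eq, Set.mem_union, eq_mul_inv_iff_mul_eq,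
      eq_comm (a := p.1)]
    tauto
  have hfin := exitPairs_finite hF
  rw [bsBoundary, hsplit,
    Set.ncard_union_eq _ (((hfin _).union (hfin _)).union (hfin _)) (hfin _),
    Set.ncard_union_eq _ ((hfin _).union (hfin _)) (hfin _),
    Set.ncard_union_eq (disjoint_exitPairs F hab) (hfin _) (hfin _)]
  · exact (disjoint_exitPairs F haa).union_left (disjoint_exitPairs F hba')
  · exact ((disjoint_exitPairs F hab').union_left (disjoint_exitPairs F hbb)).union_left
      (disjoint_exitPairs F (inv_injective.ne hab))

theorem bsBoundary_bsRect {N : ℕ} (hN : 2 ≤ N) {m : ℕ} (hm : 1 ≤ m) :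
    bsBoundary N (bsRect N m) = 2 * N ^ m + 2 * ∑ i ∈ Finset.range m, N ^ i := by
  have hpow : ∀ i ∈ Finset.range m, N ^ i ≤ N ^ m := fun i hi =>
    Nat.pow_le_pow_right (by lia) (Finset.mem_range.1 hi).le
  have ha : (exitPairs (bsRect N m) (bsa N)).ncard = ∑ i ∈ Finset.range m, N ^ i := by
    rw [ncard_exitPairs_bsRect hN m _ (fun k i => N ^ m ≤ k + N ^ i) fun k i hk hi => by
      rw [bs_normal_mul_bsa, mem_bsRect hN]; lia]
    refine Finset.sum_congr rfl fun i hi => ?_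
    have : {k ∈ Finset.range (N ^ m) | N ^ m ≤ k + N ^ i} =
        Finset.Ico (N ^ m - N ^ i) (N ^ m) := by
      ext k
      simp only [Finset.mem_filter, Finset.mem_range, Finset.mem_Ico]
      lia
    rw [this, Nat.card_Ico, Nat.sub_sub_self (hpow i hi)]
  have ha' : (exitPairs (bsRect N m) (bsa N)⁻¹).ncard = ∑ i ∈ Finset.range m, N ^ i := by
    rw [ncard_exitPairs_bsRect hN m _ (fun k i => k < N ^ i) fun k i hk hi => by
      rw [mul_bsa_inv_mem_bsRect hN hk hi, not_le]]
    refine Finset.sum_congr rfl fun i hi => ?_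
    have : {k ∈ Finset.range (N ^ m) | k < N ^ i} = Finset.range (N ^ i) := by
      ext k
      have := hpow i hi
      simp only [Finset.mem_filter, Finset.mem_range]
      lia
    rw [this, Finset.card_range]
  have hb : (exitPairs (bsRect N m) (bsb N)).ncard = N ^ m := by
    rw [ncard_exitPairs_bsRect hN m _ (fun _ i => i = m - 1) fun k i hk hi => by
      rw [bs_normal_mul_bsb, mem_bsRect hN]; lia]
    rw [Finset.sum_eq_single_of_mem (m - 1) (Finset.mem_range.2 (by lia))]
    · simp
    · intro i _ hi
      simp [hi]
  have hb' : (exitPairs (bsRect N m) (bsb N)⁻¹).ncard = N ^ m := by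
    rw [ncard_exitPairs_bsRect hN m _ (fun _ i => i = 0) fun k i hk hi => by
      rw [mul_bsb_inv_mem_bsRect hN hk hi]; lia]
    rw [Finset.sum_eq_single_of_mem 0 (Finset.mem_range.2 (by lia))]
    · simp
    · intro i _ hi
      simp [hi]
  rw [bsBoundary_eq_sum hN (bsRect_finite N m), ha, ha', hb, hb']
  ring

/-- The boundary edge counts `γ_m = |E(R_m, Γ∖R_m)|` of the rectangles `R_m` satisfy
`γ_1 = 2N + 2`, `γ_m = 2 + N·γ_{m−1}` for `m ≥ 2`, and `γ_m = 2(N^{m+1} − 1)/(N − 1)`. -/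
theorem stmt16 (N : ℕ) (hN : 2 ≤ N) :
    bsBoundary N (bsRect N 1) = 2 * N + 2 ∧
    (∀ m : ℕ, 2 ≤ m → bsBoundary N (bsRect N m) = 2 + N * bsBoundary N (bsRect N (m - 1))) ∧
    (∀ m : ℕ, 1 ≤ m → (N - 1) * bsBoundary N (bsRect N m) = 2 * (N ^ (m + 1) - 1)) := by
  refine ⟨?_, fun m hm => ?_, fun m hm => ?_⟩
  · rw [bsBoundary_bsRect hN le_rfl]
    simp
  · obtain ⟨n, rfl⟩ : ∃ n, m = n + 1 := ⟨m - 1, by lia⟩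
    rw [Nat.add_sub_cancel, bsBoundary_bsRect hN (by lia), bsBoundary_bsRect hN (by lia),
      geom_sum_succ]
    ring
  · have hgeom : (N - 1) * ∑ i ∈ Finset.range m, N ^ i + 1 = N ^ m := by
      rw [Nat.geomSum_eq hN, Nat.mul_div_cancel' (Nat.sub_one_dvd_pow_sub_one N m)]
      exact Nat.sub_add_cancel (Nat.one_le_pow _ _ (by lia))
    obtain ⟨n, rfl⟩ : ∃ n, N = n + 1 := ⟨N - 1, by lia⟩
    rw [bsBoundary_bsRect hN hm]
    simp only [Nat.add_sub_cancel] at hgeom ⊢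
    rw [pow_succ, mul_add, mul_left_comm n 2 (∑ _ ∈ _, _), mul_left_comm n 2 (_ ^ _), ← mul_add]
    congr 1
    apply Nat.eq_sub_of_add_eq
    rw [add_assoc, hgeom]
    ring
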